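/- Every finitely generated torsion subgroup of GL_n(ℂ) is finite. -/

import Mathlib

open Matrix

universe u

theorem Matrix.eq_one_of_pow_eq_one_of_map_eq_one {ι A K : Type*} [Fintype ι] [DecidableEq ι]
    [CommRing A] [IsDomain A] [Field K] (f : A →+* K) {M : Matrix ι ι A} {k : ℕ}
    (hk : (k : K) ≠ 0) (hpow : M ^ k = 1) (hM : f.mapMatrix M = 1) : M = 1 := by
  set P := ∑ i ∈ Finset.range k, M ^ i with hP
  have hmul : P * (M - 1) = 0 := by rw [hP, geom_sum_mul, hpow, sub_self]
  have hdet : P.det ≠ 0 := by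
    intro h
    have hmap : f.mapMatrix P = (k : K) • (1 : Matrix ι ι K) := by
      simp [hP, map_sum, map_pow, hM, Nat.cast_smul_eq_nsmul]
    have := f.map_det P
    rw [h, map_zero, hmap, det_smul, det_one, mul_one] at this
    exact pow_ne_zero _ hk this.symm
  have hsmul : P.det • (M - 1) = 0 := by
    rw [← one_mul (M - 1), ← smul_mul_assoc, ← adjugate_mul, mul_assoc, hmul, mul_zero]
  exact sub_eq_zero.mp ((smul_eq_zero.mp hsmul).resolve_left hdet)

theorem Int.isJacobsonRing : IsJacobsonRing ℤ := by
  refine isJacobsonRing_iff_prime_eq.mpr fun P hP ↦ ?_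
  by_cases hbot : P = ⊥
  · subst hbot
    refine eq_bot_iff.mpr fun x hx ↦ ?_
    rcases Int.isUnit_iff.mp (Ideal.mem_jacobson_bot.mp hx x) with h | h
    · simpa using h
    · nlinarith
  · have := IsPrime.to_maximal_ideal hbot
    exact Ideal.jacobson_eq_self_of_isMaximal

theorem finite_of_surjective_of_finiteType_int {A K : Type*} [CommRing A]
    [Algebra.FiniteType ℤ A] [Field K] (f : A →+* K) (hf : Function.Surjective f) :
    Finite K := by
  have : Algebra.FiniteType ℤ K := .of_surjective f.toIntAlgHom hf
  have := Int.isJacobsonRing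
  have : Module.Finite ℤ K := finite_of_finite_type_of_isJacobsonRing ℤ K
  obtain ⟨p, hp⟩ := CharP.exists K
  rcases CharP.char_is_prime_or_zero K p with hprime | rfl
  · have : Fact p.Prime := ⟨hprime⟩
    let _ : Algebra (ZMod p) K := ZMod.algebra K p
    have : Module.Finite (ZMod p) K := Module.Finite.of_restrictScalars_finite ℤ (ZMod p) K
    exact Module.finite_of_finite (ZMod p)
  · have : CharZero K := CharP.charP_to_charZero K
    exact (Int.not_isField (isField_of_isIntegral_of_isField
      (RingHom.injective_int (algebraMap ℤ K)) (Field.toIsField K))).elim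

theorem exists_ringHom_finite_field (A : Type u) [CommRing A] [Nontrivial A]
    [Algebra.FiniteType ℤ A] : ∃ (K : Type u) (_ : Field K), Finite K ∧ Nonempty (A →+* K) := by
  obtain ⟨m, hm⟩ := Ideal.exists_maximal A
  let _ : Field (A ⧸ m) := Ideal.Quotient.field m
  exact ⟨A ⧸ m, inferInstance,
    finite_of_surjective_of_finiteType_int (Ideal.Quotient.mk m) Ideal.Quotient.mk_surjective,
    ⟨Ideal.Quotient.mk m⟩⟩

section

variable {ι : Type*} {F : Type u} [Fintype ι] [DecidableEq ι] [Field F]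

theorem Subgroup.FG.exists_finite_entries_mem_adjoin {G : Subgroup (GL ι F)} (hfg : G.FG) :
    ∃ T : Set F, T.Finite ∧ ∀ g ∈ G, ∀ i j, (g : Matrix ι ι F) i j ∈ Algebra.adjoin ℤ T := by
  obtain ⟨S, rfl⟩ := hfg
  let T : Set F := ⋃ g ∈ S, Set.range fun x : ι × ι × Bool ↦
    if x.2.2 then (g : Matrix ι ι F) x.1 x.2.1 else (g⁻¹ : GL ι F).1 x.1 x.2.1
  have hT : ∀ g ∈ S, ∀ i j, (g : Matrix ι ι F) i j ∈ T ∧ (g⁻¹ : GL ι F).1 i j ∈ T := fun g hg i j ↦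
    ⟨Set.mem_biUnion hg ⟨(i, j, true), rfl⟩, Set.mem_biUnion hg ⟨(i, j, false), rfl⟩⟩
  refine ⟨T, S.finite_toSet.biUnion fun _ _ ↦ Set.finite_range _, fun g hg ↦ ?_⟩
  suffices h : ∀ i j, (g : Matrix ι ι F) i j ∈ Algebra.adjoin ℤ T ∧
      (g⁻¹ : GL ι F).1 i j ∈ Algebra.adjoin ℤ T from fun i j ↦ (h i j).1
  induction hg using Subgroup.closure_induction with
  | mem g hg =>
    exact fun i j ↦ (hT g hg i j).imp (Algebra.subset_adjoin ·) (Algebra.subset_adjoin ·)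
  | one =>
    intro i j
    by_cases hij : i = j <;> simp [hij, one_apply]
  | mul x y _ _ hx hy =>
    intro i j
    rw [_root_.mul_inv_rev]
    exact ⟨sum_mem fun l _ ↦ mul_mem (hx i l).1 (hy l j).1,
      sum_mem fun l _ ↦ mul_mem (hy i l).2 (hx l j).2⟩
  | inv x _ hx => simpa only [inv_inv] using fun i j ↦ (hx i j).symm

/-- Reduction of a finitely generated linear group over a finite field in which a given nonzero
integer stays invertible. -/
theorem Subgroup.FG.exists_reduction [CharZero F] {G : Subgroup (GL ι F)} (hfg : G.FG)
    {a : ℕ} (ha : a ≠ 0) :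
    ∃ (K : Type u) (_ : Field K) (φ : G →* Matrix ι ι K), Finite K ∧ (a : K) ≠ 0 ∧
      ∀ (g : G) (k : ℕ), (k : K) ≠ 0 → g ^ k = 1 → φ g = 1 → g = 1 := by
  obtain ⟨T, hT, hG⟩ := hfg.exists_finite_entries_mem_adjoin
  let A := Algebra.adjoin ℤ (insert (a : F)⁻¹ T)
  have hA : ∀ (g : G) i j, (g : GL ι F).1 i j ∈ A := fun g i j ↦
    Algebra.adjoin_mono (Set.subset_insert _ _) (hG g g.2 i j)
  have : Algebra.FiniteType ℤ A := .adjoin_of_finite (hT.insert _)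
  obtain ⟨K, _, hK, ⟨f⟩⟩ := exists_ringHom_finite_field A
  let ψ : G →* Matrix ι ι A :=
    { toFun g := of fun i j ↦ ⟨(g : GL ι F).1 i j, hA g i j⟩
      map_one' := by
        ext i j
        by_cases hij : i = j <;> simp [hij, one_apply]
      map_mul' g h := by
        ext i j
        simp [mul_apply] }
  have hψ : Function.Injective ψ := fun g h hgh ↦ by
    ext i j
    exact congrArg Subtype.val (congrFun₂ hgh i j)
  refine ⟨K, inferInstance, (f.mapMatrix : Matrix ι ι A →+* Matrix ι ι K).toMonoidHom.comp ψ, hK, ?_, ?_⟩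
  · have hinv : (a : A) * ⟨(a : F)⁻¹, Algebra.subset_adjoin (Set.mem_insert _ _)⟩ = 1 := by
      ext
      simp [ha]
    intro h
    simpa [h] using congrArg f hinv
  · intro g k hk hpow hg
    apply hψ
    rw [map_one]
    exact eq_one_of_pow_eq_one_of_map_eq_one f hk (by rw [← map_pow, hpow, map_one]) hg

theorem Subgroup.FG.finite_of_isOfFinOrder [CharZero F] {G : Subgroup (GL ι F)} (hfg : G.FG)
    (htor : ∀ g ∈ G, IsOfFinOrder g) : Finite G := by
  obtain ⟨K, _, φ, _, -, hφ⟩ := hfg.exists_reduction one_ne_zero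
  obtain ⟨p, hp⟩ := CharP.exists K
  have hp0 : p ≠ 0 := CharP.char_ne_zero_of_finite K p
  obtain ⟨L, _, ψ, _, hpL, hψ⟩ := hfg.exists_reduction hp0
  have key : ∀ g : G, φ g = 1 → ψ g = 1 → g = 1 := by
    intro g hg hg'
    by_contra hne
    have hord : orderOf g ≠ 0 :=
      (Submonoid.isOfFinOrder_coe.mp (htor g g.2)).orderOf_pos.ne'
    obtain ⟨q, hq, hqd⟩ := Nat.exists_prime_and_dvd (mt orderOf_eq_one_iff.mp hne)
    set h := g ^ (orderOf g / q) with hh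
    have hoh : orderOf h = q := orderOf_pow_orderOf_div hord hqd
    have hpow : h ^ q = 1 := hoh ▸ pow_orderOf_eq_one h
    have h1 : h = 1 := by
      by_cases hqK : (q : K) = 0
      · have hqd := (CharP.cast_eq_zero_iff K p q).mp hqK
        have hpq : p = q := ((Nat.dvd_prime hq).mp hqd).resolve_left (CharP.char_ne_one K p)
        exact hψ h q (hpq ▸ hpL) hpow (by rw [hh, map_pow, hg', one_pow])
      · exact hφ h q hqK hpow (by rw [hh, map_pow, hg, one_pow])
    exact hq.one_lt.ne' (by rw [← hoh, h1, orderOf_one])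
  let Φ := (φ.prod ψ).toHomUnits
  have hΦ : Function.Injective Φ := (injective_iff_map_eq_one Φ).mpr fun g hg ↦ by
    have h : (φ g, ψ g) = 1 := congrArg Units.val hg
    exact key g (congrArg Prod.fst h) (congrArg Prod.snd h)
  exact Finite.of_injective Φ hΦ

end

/-- Schur's theorem: a finitely generated torsion subgroup of `GL_n(ℂ)` is finite. -/
theorem schur_fg_torsion_linear_group_finite
    (n : ℕ) (G : Subgroup (GL (Fin n) ℂ)) (hfg : G.FG)
    (htor : ∀ g ∈ G, IsOfFinOrder g) :
    Finite G :=
  hfg.finite_of_isOfFinOrder htor
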